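/- arXiv:2412.04995 — 5 statements merged into one kernel-verified Lean document; each statement's English description precedes it below -/
import Mathlib

section
/- Let H be an abelian group, G a subgroup of H, and f : H → G' a homomorphism of abelian groups. Then the following are equivalent: (a) there exists a homomorphism f' : H → G with ker f' = ker f such that f'(x) = x for every x ∈ G; (b) the restriction of f to G is injective and f(G) = im f. -/
/-- Let `G` be a subgroup of an abelian group `H` and `f : H →+ G'`.
There exists a homomorphism `f' : H →+ G` fixing `G` with `ker f' = ker f`
iff `f` is injective on `G` and `f(G) = im f`. -/
theorem exists_fixing_hom_iff_injOn_and_image_eq_range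
    {H G' : Type*} [AddCommGroup H] [AddCommGroup G']
    (G : AddSubgroup H) (f : H →+ G') :
    (∃ f' : H →+ G, f'.ker = f.ker ∧ ∀ x ∈ G, (f' x : H) = x) ↔
      (Set.InjOn f (G : Set H) ∧ f '' (G : Set H) = Set.range f) := by
  constructor
  · rintro ⟨f', hker, hfix⟩
    have hiff (x y : H) : f' x = f' y ↔ f x = f y := by
      rw [← sub_eq_zero, ← map_sub, ← AddMonoidHom.mem_ker, hker, AddMonoidHom.mem_ker,
        map_sub, sub_eq_zero]
    refine ⟨fun x hx y hy hxy => ?_, (Set.image_subset_range _ _).antisymm ?_⟩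
    · rw [← hfix x hx, ← hfix y hy, (hiff x y).2 hxy]
    · rintro _ ⟨h, rfl⟩
      exact ⟨f' h, (f' h).2, (hiff _ _).1 (Subtype.ext (hfix _ (f' h).2))⟩
  · rintro ⟨hinj, himage⟩
    have hex (h : H) : ∃ g ∈ G, f g = f h := by
      have hmem : f h ∈ f '' (G : Set H) := himage ▸ Set.mem_range_self h
      exact hmem
    choose g hgG hg using hex
    refine ⟨AddMonoidHom.mk' (fun h => ⟨g h, hgG h⟩) fun a b => Subtype.ext ?_, ?_, fun x hx => ?_⟩
    · exact hinj (hgG _) (G.add_mem (hgG a) (hgG b)) (by simp only [AddSubgroup.coe_add, map_add, hg])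
    · ext h
      simp only [AddMonoidHom.mem_ker, AddMonoidHom.mk'_apply, AddSubgroup.mk_eq_zero]
      refine ⟨fun h0 => ?_, fun h0 => ?_⟩
      · rw [← hg h, h0, map_zero]
      · exact hinj (hgG h) G.zero_mem (by rw [hg, h0, map_zero])
    · exact hinj (hgG x) hx (hg x)
end

section
/- Let H be an abelian group, G a subgroup of H, and f : H → G' a homomorphism of abelian groups. Then the following are equivalent: (a) there exists a homomorphism f' : H → G with ker f' = ker f such that f'(x) = x for every x ∈ G; (b) the restriction of f to G is injective, and for every subset J ⊆ G that generates G as a group, the set {f(x) : x ∈ J} generates im f. -/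
/-- If `f` is injective on `G` and maps `G` onto `f.range`, then `H` retracts onto `G`
compatibly with `f`. -/
theorem exists_hom_comp_eq_of_injOn_of_map_eq_range
    {H G' : Type*} [AddCommGroup H] [AddCommGroup G'] {G : AddSubgroup H} {f : H →+ G'}
    (hinj : Set.InjOn f (G : Set H)) (hmap : G.map f = f.range) :
    ∃ f' : H →+ G, ∀ x, f (f' x) = f x := by
  have hex : ∀ x, ∃ y : G, f y = f x := fun x => by
    have hx : f x ∈ G.map f := hmap ▸ ⟨x, rfl⟩
    obtain ⟨y, hy, hyx⟩ := hx
    exact ⟨⟨y, hy⟩, hyx⟩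
  choose g hg using hex
  refine ⟨AddMonoidHom.mk' g fun x y => Subtype.ext (hinj (g _).2 (g x + g y).2 ?_), hg⟩
  simp [hg]


/-- Let `G` be a subgroup of an abelian group `H` and `f : H →+ G'`.
There exists a homomorphism `f' : H →+ G` fixing `G` with `ker f' = ker f`
iff `f` is injective on `G` and, for every generating set `J` of `G`,
the image `f '' J` generates `im f`. -/
theorem exists_fixing_hom_iff_injOn_and_generates
    {H G' : Type*} [AddCommGroup H] [AddCommGroup G']
    (G : AddSubgroup H) (f : H →+ G') :
    (∃ f' : H →+ G, f'.ker = f.ker ∧ ∀ x ∈ G, (f' x : H) = x) ↔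
      (Set.InjOn f (G : Set H) ∧
        ∀ J : Set H, J ⊆ (G : Set H) → AddSubgroup.closure J = G →
          AddSubgroup.closure (f '' J) = f.range) := by
  constructor
  · rintro ⟨f', hker, hfix⟩
    have hiff : ∀ x y, f' x = f' y ↔ f x = f y := fun x y => by
      rw [← sub_eq_zero, ← map_sub, ← AddMonoidHom.mem_ker, hker, AddMonoidHom.mem_ker, map_sub,
        sub_eq_zero]
    refine ⟨fun x hx y hy hxy => ?_, fun J _ hJ => ?_⟩
    · rw [← hfix x hx, ← hfix y hy, (hiff x y).2 hxy]
    · rw [← AddMonoidHom.map_closure, hJ]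
      refine le_antisymm (AddSubgroup.map_le_range f G) ?_
      rintro _ ⟨x, rfl⟩
      exact ⟨f' x, (f' x).2, (hiff _ _).1 (Subtype.ext (hfix _ (f' x).2))⟩
  · rintro ⟨hinj, hgen⟩
    have hmap : G.map f = f.range := by
      rw [← hgen G subset_rfl G.closure_eq, ← AddMonoidHom.map_closure, G.closure_eq]
    obtain ⟨f', hf'⟩ := exists_hom_comp_eq_of_injOn_of_map_eq_range hinj hmap
    refine ⟨f', ?_, fun x hx => hinj (f' x).2 hx (hf' x)⟩
    ext x
    rw [AddMonoidHom.mem_ker, AddMonoidHom.mem_ker, ← hf' x]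
    refine ⟨fun h => by simp [h], fun h => Subtype.ext (hinj (f' x).2 G.zero_mem ?_)⟩
    simpa using h
end

section
/- Let H be an abelian group and G a subgroup of H. Let f : H → K and g : H → K' be homomorphisms such that there exist homomorphisms f₀, g₀ : H → G fixing G (i.e. f₀(x) = x = g₀(x) for all x ∈ G) with ker f = ker f₀ and ker g = ker g₀. Then either ker f = ker g, or neither ker f ⊆ ker g nor ker g ⊆ ker f. -/
/-- If the kernels of two retractions onto the same subgroup are nested, then they are equal. -/
theorem AddMonoidHom.ker_eq_of_ker_le_of_fixes {H : Type*} [AddCommGroup H]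
    {G : AddSubgroup H} {p q : H →+ G}
    (hp : ∀ x ∈ G, (p x : H) = x) (hq : ∀ x ∈ G, (q x : H) = x)
    (h : p.ker ≤ q.ker) : p.ker = q.ker := by
  refine le_antisymm h fun x hx => ?_
  have hpp : p (p x : H) = p x := Subtype.ext (hp _ (p x).2)
  have hqp : q (p x : H) = p x := Subtype.ext (hq _ (p x).2)
  have hsub : x - (p x : H) ∈ q.ker := h (by simp [AddMonoidHom.mem_ker, hpp])
  rw [AddMonoidHom.mem_ker] at hx ⊢
  rwa [AddMonoidHom.mem_ker, map_sub, hx, hqp, zero_sub, neg_eq_zero] at hsub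

/-- Let `G` be a subgroup of an abelian group `H`, and let
`f : H →+ K`, `g : H →+ K'` be homomorphisms admitting homomorphisms
`f₀, g₀ : H →+ G` fixing `G` with `ker f = ker f₀` and `ker g = ker g₀`.
Then either `ker f = ker g`, or neither kernel is contained in the other. -/
theorem barcoding_equivalent_ker_eq_or_incomparable
    {H K K' : Type*} [AddCommGroup H] [AddCommGroup K] [AddCommGroup K']
    (G : AddSubgroup H) (f : H →+ K) (g : H →+ K')
    (f₀ g₀ : H →+ G)
    (hf₀ : ∀ x ∈ G, (f₀ x : H) = x) (hg₀ : ∀ x ∈ G, (g₀ x : H) = x)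
    (hkf : f.ker = f₀.ker) (hkg : g.ker = g₀.ker) :
    f.ker = g.ker ∨ (¬ f.ker ≤ g.ker ∧ ¬ g.ker ≤ f.ker) := by
  rw [hkf, hkg]
  by_cases h : f₀.ker = g₀.ker
  · exact Or.inl h
  · exact Or.inr ⟨fun hle => h (AddMonoidHom.ker_eq_of_ker_le_of_fixes hf₀ hg₀ hle),
      fun hle => h (AddMonoidHom.ker_eq_of_ker_le_of_fixes hg₀ hf₀ hle).symm⟩
end

section
/- Let H be an abelian group and let G ⊊ G' be subgroups of H with G strictly contained in G'. Let f : H → G be a homomorphism fixing G (f(x) = x for all x ∈ G) and let g : H → G' be a homomorphism fixing G' (g(x) = x for all x ∈ G'). Then ker f is not contained in ker g; consequently, either ker g is strictly contained in ker f, or neither of ker f and ker g contains the other. -/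
/-- Let `G ⊊ G'` be subgroups of an abelian group `H`, let
`f : H →+ G` fix `G` and let `g : H →+ G'` fix `G'`. Then `ker f ⊄ ker g`;
consequently either `ker g ⊊ ker f`, or neither kernel contains the other. -/
theorem ker_not_le_of_fixing_smaller
    {H : Type*} [AddCommGroup H]
    (G G' : AddSubgroup H) (hGG' : G < G')
    (f : H →+ G) (hf : ∀ x ∈ G, (f x : H) = x)
    (g : H →+ G') (hg : ∀ x ∈ G', (g x : H) = x) :
    ¬ f.ker ≤ g.ker ∧
      (g.ker < f.ker ∨ (¬ f.ker ≤ g.ker ∧ ¬ g.ker ≤ f.ker)) := by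
  have key : ¬ f.ker ≤ g.ker := by
    intro hle
    obtain ⟨x, hx', hx⟩ := SetLike.exists_of_lt hGG'
    have hmem : x - (f x : H) ∈ f.ker := by
      rw [AddMonoidHom.mem_ker, map_sub, sub_eq_zero]
      exact Subtype.ext (hf _ (f x).2).symm
    have hg0 : g (x - (f x : H)) = 0 := hle hmem
    have hfix := hg _ (G'.sub_mem hx' (hGG'.le (f x).2))
    rw [hg0, AddSubgroup.coe_zero, eq_comm, sub_eq_zero] at hfix
    exact hx (hfix ▸ (f x).2)
  refine ⟨key, ?_⟩
  by_cases h : g.ker ≤ f.ker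
  · exact Or.inl (lt_of_le_not_ge h key)
  · exact Or.inr ⟨key, h⟩
end

section
/- Let P be a poset (regarded as a category), k a field, and I an interval of P, i.e. a nonempty full subposet of P that is connected and convex. Then the interval representation k_I : P ⥤ Vect_k is indecomposable: k_I is nonzero, and whenever k_I is isomorphic to a direct sum M ⊕ N of two representations M, N of P (with direct sums computed pointwise), one of M or N is the zero representation. -/
/-! Self-contained setup for representations of a poset `P` over a field `k`,
pointwise direct sums, isomorphisms of representations, intervals of `P`,
and interval representations. -/

/-- A `k`-representation of a poset `P`: a functor from `P` (viewed as a category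
with a unique morphism `x → y` whenever `x ≤ y`) to `k`-vector spaces. -/
structure PosetRep (P : Type*) [PartialOrder P] (k : Type*) [Field k] where
  /-- The vector space attached to each point. -/
  V : P → Type*
  [addCommGroup : ∀ x, AddCommGroup (V x)]
  [module : ∀ x, Module k (V x)]
  /-- The structure (internal) linear map attached to each relation `x ≤ y`. -/
  map : ∀ {x y : P}, x ≤ y → (V x →ₗ[k] V y)
  map_id : ∀ x : P, map (le_refl x) = LinearMap.id
  map_comp : ∀ {x y z : P} (hxy : x ≤ y) (hyz : y ≤ z),
    map (hxy.trans hyz) = (map hyz).comp (map hxy)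

attribute [instance] PosetRep.addCommGroup PosetRep.module

variable {P : Type*} [PartialOrder P] {k : Type*} [Field k]

/-- The pointwise direct sum of two representations of `P`. -/
def PosetRep.dsum (M N : PosetRep P k) : PosetRep P k where
  V x := M.V x × N.V x
  map h := (M.map h).prodMap (N.map h)
  map_id x := by
    show (M.map (le_refl x)).prodMap (N.map (le_refl x)) = LinearMap.id
    rw [M.map_id, N.map_id]
    ext v <;> rfl
  map_comp {x y z} hxy hyz := by
    show (M.map (hxy.trans hyz)).prodMap (N.map (hxy.trans hyz)) = _
    rw [M.map_comp hxy hyz, N.map_comp hxy hyz]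
    ext v <;> rfl

/-- A representation is zero if it assigns the zero vector space to every point. -/
def PosetRep.IsZero (M : PosetRep P k) : Prop :=
  ∀ x : P, ∀ v : M.V x, v = 0

/-- An isomorphism of representations of `P`: a pointwise linear isomorphism
commuting with the structure maps. -/
structure PosetRepIso (M N : PosetRep P k) where
  /-- The pointwise linear isomorphisms. -/
  hom : ∀ x : P, M.V x ≃ₗ[k] N.V x
  comm : ∀ {x y : P} (h : x ≤ y),
    (hom y).toLinearMap.comp (M.map h) = (N.map h).comp (hom x).toLinearMap

/-- A subset `I` of `P` is connected (as a full subposet) if it is nonempty and any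
two of its points are joined by a zigzag inside `I`. -/
def IsConnectedSubposet (I : Set P) : Prop :=
  I.Nonempty ∧ ∀ x ∈ I, ∀ y ∈ I, ∃ (n : ℕ) (c : Fin (n + 1) → P),
    (∀ i, c i ∈ I) ∧ c 0 = x ∧ c (Fin.last n) = y ∧
    ∀ i : Fin n, c i.castSucc ≤ c i.succ ∨ c i.succ ≤ c i.castSucc

/-- A subset `I` of `P` is convex if `x ≤ y ≤ z` with `x, z ∈ I` implies `y ∈ I`. -/
def IsConvexSubposet (I : Set P) : Prop :=
  ∀ ⦃x y z : P⦄, x ≤ y → y ≤ z → x ∈ I → z ∈ I → y ∈ I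

open Classical in
/-- The one-dimensional space `k` (realized as the full submodule of `k`)
at points of `I`, and the zero space elsewhere. -/
noncomputable def intervalSpace (k : Type*) [Field k] (I : Set P) (x : P) :
    Submodule k k :=
  if x ∈ I then ⊤ else ⊥

open Classical in
/-- The internal map of the interval representation: the identity of `k` between
points of `I`, and zero otherwise. -/
noncomputable def intervalMap (k : Type*) [Field k] (I : Set P) {x y : P}
    (_h : x ≤ y) : intervalSpace k I x →ₗ[k] intervalSpace k I y :=
  if hxy : x ∈ I ∧ y ∈ I then
    LinearMap.codRestrict _ (intervalSpace k I x).subtype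
      (fun _c => by rw [intervalSpace, if_pos hxy.2]; trivial)
  else 0

/-- The interval representation `k_I` of a convex subset `I ⊆ P`. -/
noncomputable def intervalRep (k : Type*) [Field k] (I : Set P)
    (hconv : IsConvexSubposet I) : PosetRep P k where
  V x := intervalSpace k I x
  map h := intervalMap k I h
  map_id x := by
    show intervalMap k I (le_refl x) = LinearMap.id
    by_cases hx : x ∈ I
    · rw [intervalMap, dif_pos ⟨hx, hx⟩]
      ext c
      rfl
    · rw [intervalMap, dif_neg (by tauto)]
      ext c
      have hc : (c : k) = 0 := by
        have h2 := c.2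
        simp only [intervalSpace, if_neg hx] at h2
        simpa using h2
      simp [hc]
  map_comp {x y z} hxy hyz := by
    show intervalMap k I (hxy.trans hyz) = (intervalMap k I hyz).comp (intervalMap k I hxy)
    by_cases hx : x ∈ I
    · by_cases hz : z ∈ I
      · have hy : y ∈ I := hconv hxy hyz hx hz
        rw [intervalMap, dif_pos ⟨hx, hz⟩, intervalMap, dif_pos ⟨hy, hz⟩,
          intervalMap, dif_pos ⟨hx, hy⟩]
        ext c
        rfl
      · rw [intervalMap, dif_neg (show ¬(x ∈ I ∧ z ∈ I) by tauto)]
        conv_rhs => rw [intervalMap, dif_neg (show ¬(y ∈ I ∧ z ∈ I) by tauto)]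
        simp
    · rw [intervalMap, dif_neg (show ¬(x ∈ I ∧ z ∈ I) by tauto)]
      conv_rhs => rw [intervalMap, intervalMap, dif_neg (show ¬(x ∈ I ∧ y ∈ I) by tauto)]
      simp

/-- A predicate preserved along every comparability inside a connected subposet is constant
on it. -/
theorem IsConnectedSubposet.iff_of_iff_of_le {I : Set P} (hI : IsConnectedSubposet I)
    {p : P → Prop} (hp : ∀ ⦃x y : P⦄, x ≤ y → x ∈ I → y ∈ I → (p x ↔ p y))
    {x y : P} (hx : x ∈ I) (hy : y ∈ I) : p x ↔ p y := by
  obtain ⟨n, c, hc, rfl, rfl, hstep⟩ := hI.2 x hx y hy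
  suffices ∀ i, p (c 0) ↔ p (c i) from this _
  intro i
  induction i using Fin.induction with
  | zero => rfl
  | succ i ih =>
    refine ih.trans ?_
    rcases hstep i with h | h
    · exact hp h (hc _) (hc _)
    · exact (hp h (hc _) (hc _)).symm

/-- If `(a, b)` spans a product of two vector spaces, one of `a`, `b` vanishes. -/
theorem eq_zero_or_eq_zero_of_forall_exists_smul {V W : Type*} [AddCommGroup V] [Module k V]
    [AddCommGroup W] [Module k W] {w : V × W} (hw : ∀ u : V × W, ∃ c : k, u = c • w) :
    w.1 = 0 ∨ w.2 = 0 := by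
  obtain ⟨c, hc⟩ := hw (w.1, 0)
  obtain ⟨h₁, h₂⟩ := Prod.ext_iff.1 hc
  rcases smul_eq_zero.1 (show c • w.2 = 0 from h₂.symm) with rfl | h
  · exact Or.inl (h₁.trans (zero_smul k w.1))
  · exact Or.inr h

/-- The element `1` of the interval space at a point of `I`. -/
def intervalOne (k : Type*) [Field k] {α : Type*} {I : Set α} {x : α} (hx : x ∈ I) :
    intervalSpace k I x :=
  ⟨1, by rw [intervalSpace, if_pos hx]; trivial⟩

theorem intervalOne_ne_zero {α : Type*} {I : Set α} {x : α} (hx : x ∈ I) : intervalOne k hx ≠ 0 :=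
  fun h => one_ne_zero (congrArg Subtype.val h)

theorem eq_smul_intervalOne {α : Type*} {I : Set α} {x : α} (hx : x ∈ I)
    (v : intervalSpace k I x) : v = (v : k) • intervalOne k hx :=
  Subtype.ext (mul_one (v : k)).symm

theorem intervalMap_intervalOne {I : Set P} {x y : P} (h : x ≤ y) (hx : x ∈ I) (hy : y ∈ I) :
    intervalMap k I h (intervalOne k hx) = intervalOne k hy := by
  rw [intervalMap, dif_pos ⟨hx, hy⟩]
  rfl

theorem intervalSpace_eq_zero {α : Type*} {I : Set α} {x : α} (hx : x ∉ I)
    (v : intervalSpace k I x) : v = 0 := by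
  have h := v.2
  simp only [intervalSpace, if_neg hx] at h
  exact Subtype.ext (by simpa using h)

/-- For any interval `I` (a nonempty connected convex full
subposet) of a poset `P` and any field `k`, the interval representation `k_I`
is indecomposable: it is nonzero, and whenever it is isomorphic to a pointwise
direct sum `M ⊕ N`, one of `M`, `N` is the zero representation. -/
theorem intervalRep_indecomposable
    (P : Type*) [PartialOrder P] (k : Type*) [Field k] (I : Set P)
    (hconn : IsConnectedSubposet I) (hconv : IsConvexSubposet I) :
    ¬ (intervalRep k I hconv).IsZero ∧
      ∀ (M N : PosetRep P k),
        PosetRepIso (intervalRep k I hconv) (M.dsum N) → M.IsZero ∨ N.IsZero := by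
  obtain ⟨x₀, hx₀⟩ := hconn.1
  refine ⟨fun h => intervalOne_ne_zero hx₀ (h x₀ (intervalOne k hx₀)), fun M N e => ?_⟩
  let φ (x : P) : intervalSpace k I x ≃ₗ[k] M.V x × N.V x := e.hom x
  have hspan : ∀ {x} (hx : x ∈ I) (u : M.V x × N.V x),
      ∃ c : k, u = c • φ x (intervalOne k hx) := fun {x} hx u =>
    ⟨(φ x).symm u, by
      rw [← map_smul, ← eq_smul_intervalOne, LinearEquiv.apply_symm_apply]⟩
  have hne : ∀ {x} (hx : x ∈ I), φ x (intervalOne k hx) ≠ 0 := fun {x} hx =>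
    (φ x).map_ne_zero_iff.2 (intervalOne_ne_zero hx)
  have hmap : ∀ {x y} (h : x ≤ y) (hx : x ∈ I) (hy : y ∈ I),
      φ y (intervalOne k hy) =
        (M.map h (φ x (intervalOne k hx)).1, N.map h (φ x (intervalOne k hx)).2) := by
    intro x y h hx hy
    rw [← intervalMap_intervalOne h hx hy]
    exact LinearMap.congr_fun (e.comm h) (intervalOne k hx)
  have hout : ∀ {x}, x ∉ I → ∀ u : M.V x × N.V x, u = 0 := fun {x} hx u =>
    (φ x).symm.map_eq_zero_iff.1 (intervalSpace_eq_zero hx _)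
  have hor : ∀ {x} (hx : x ∈ I),
      (φ x (intervalOne k hx)).1 = 0 ∨ (φ x (intervalOne k hx)).2 = 0 := fun hx =>
    eq_zero_or_eq_zero_of_forall_exists_smul (hspan hx)
  have hconst : ∀ {x} (hx : x ∈ I),
      (φ x₀ (intervalOne k hx₀)).1 = 0 ↔ (φ x (intervalOne k hx)).1 = 0 := by
    intro x hx
    have := hconn.iff_of_iff_of_le (p := fun x => ∀ hx : x ∈ I, (φ x (intervalOne k hx)).1 = 0)
      (fun x y h hx hy => ?_) hx₀ hx
    · simpa only [hx₀, hx, forall_true_left] using this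
    · refine ⟨fun H _ => by rw [hmap h hx hy, H hx, map_zero], fun H _ => ?_⟩
      refine (hor hx).resolve_right fun h₂ => hne hy (Prod.ext (H hy) ?_)
      rw [hmap h hx hy, h₂, map_zero]
      rfl
  rcases hor hx₀ with h₁ | h₂
  · left
    intro x v
    by_cases hx : x ∈ I
    · obtain ⟨c, hc⟩ := hspan hx (v, 0)
      rw [show v = c • (φ x (intervalOne k hx)).1 from congrArg Prod.fst hc,
        (hconst hx).1 h₁, smul_zero]
    · exact congrArg Prod.fst (hout hx (v, 0))
  · right
    intro x v
    by_cases hx : x ∈ I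
    · have h₂x : (φ x (intervalOne k hx)).2 = 0 :=
        (hor hx).resolve_left fun h => hne hx₀ (Prod.ext ((hconst hx).2 h) h₂)
      obtain ⟨c, hc⟩ := hspan hx (0, v)
      rw [show v = c • (φ x (intervalOne k hx)).2 from congrArg Prod.snd hc, h₂x, smul_zero]
    · exact congrArg Prod.snd (hout hx (0, v))
end
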